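/- arXiv:math/0612770 — 2 statements merged into one kernel-verified Lean document; each statement's English description precedes it below -/
import Mathlib

section
/- Fix δ > 0. For every ε > 0, the proportion of ν ∈ Π̃_{n,n+δ} whose number of vertices card(supp ν) satisfies |card(supp ν) − (3/(4π·ζ(3)²))^{1/3}·n^{2/3}| > ε·n^{2/3} tends to 0 as n → ∞; that is, the typical number of vertices of an element of Π̃_{n,n+δ} is asymptotically (3/(4π·ζ(3)²))^{1/3}·n^{2/3}, where ζ(3) = ∑_{k≥1} 1/k³. -/
open Real Filter

/-- The set of pairs of coprime nonnegative integers (including `(0,1)` and `(1,0)`). -/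
abbrev Xc : Type := {x : ℕ × ℕ // Nat.gcd x.1 x.2 = 1}

/-- The total length `∑_{x∈X} ν(x)·√(x₁²+x₂²)` of the chain encoded by `ν`. -/
noncomputable def totalLength (ν : Xc →₀ ℕ) : ℝ :=
  ν.sum fun x m => (m : ℝ) * Real.sqrt ((x.val.1 : ℝ) ^ 2 + (x.val.2 : ℝ) ^ 2)

noncomputable def zeta3 : ℝ := ∑' k : ℕ, 1 / ((k : ℝ) + 1) ^ 3

open scoped Topology

/-- The Euclidean norm of a pair of natural numbers. -/
noncomputable def latNorm (p : ℕ × ℕ) : ℝ := √((p.1 : ℝ) ^ 2 + (p.2 : ℝ) ^ 2)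

open MeasureTheory in
theorem integral_quadrant_exp_neg_norm :
    ∫ p, rexp (-√(p.1 ^ 2 + p.2 ^ 2))
      ∂((volume.restrict (Set.Ioi (0 : ℝ))).prod (volume.restrict (Set.Ioi (0 : ℝ)))) = π / 2 := by
  have hplane : ∫ p : ℝ × ℝ, rexp (-√(p.1 ^ 2 + p.2 ^ 2)) = 2 * π := by
    have h := Complex.integral_exp_neg_rpow (p := 1) le_rfl
    rw [← Complex.volume_preserving_equiv_real_prod.integral_comp
      Complex.measurableEquivRealProd.measurableEmbedding]
    have hΓ : Real.Gamma (2 / 1 + 1) = 2 := by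
      have := Real.Gamma_nat_eq_factorial 2
      norm_num at this ⊢
    rw [hΓ] at h
    rw [mul_comm 2 π, ← h]
    refine integral_congr_ae (.of_forall fun z => ?_)
    simp [Complex.measurableEquivRealProd_apply, Complex.norm_eq_sqrt_sq_add_sq]
  have hint : Integrable fun p : ℝ × ℝ => rexp (-√(p.1 ^ 2 + p.2 ^ 2)) := by
    by_contra hne
    rw [integral_undef hne] at hplane
    linarith [pi_pos]
  have hrestrict : Integrable (fun p : ℝ × ℝ => rexp (-√(p.1 ^ 2 + p.2 ^ 2)))
      ((volume.restrict (Set.Ioi (0 : ℝ))).prod (volume.restrict (Set.Ioi (0 : ℝ)))) := by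
    rw [Measure.prod_restrict]
    exact hint.restrict
  rw [integral_prod _ hrestrict]
  rw [Measure.volume_eq_prod, integral_prod _ hint] at hplane
  have hinner : ∀ x : ℝ, ∫ y, rexp (-√(x ^ 2 + y ^ 2)) =
      2 * ∫ y in Set.Ioi (0 : ℝ), rexp (-√(x ^ 2 + y ^ 2)) := fun x => by
    rw [← integral_comp_abs (f := fun y => rexp (-√(x ^ 2 + y ^ 2)))]
    simp
  have houter := integral_comp_abs
    (f := fun x => ∫ y in Set.Ioi (0 : ℝ), rexp (-√(x ^ 2 + y ^ 2)))
  simp only [sq_abs] at houter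
  simp only [hinner, integral_const_mul] at hplane
  rw [houter] at hplane
  linarith

theorem half_add_le_sqrt (x y : ℝ) :
    (x + y) / 2 ≤ √(x ^ 2 + y ^ 2) :=
  Real.le_sqrt_of_sq_le (by nlinarith [sq_nonneg (x - y)])

open MeasureTheory in
theorem volume_floor_div_preimage {t : ℝ} (ht : 0 < t) (a : ℕ) :
    volume ((fun x : ℝ => ⌊x / t⌋₊) ⁻¹' {a} ∩ Set.Ioi 0) = ENNReal.ofReal t := by
  have hae : ((fun x : ℝ => ⌊x / t⌋₊) ⁻¹' {a} ∩ Set.Ioi 0 : Set ℝ) =ᵐ[volume]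
      ((fun x : ℝ => ⌊x / t⌋₊) ⁻¹' {a} ∩ Set.Ici 0 : Set ℝ) :=
    (ae_eq_refl _).inter Ioi_ae_eq_Ici
  rw [measure_congr hae]
  have : ((fun x : ℝ => ⌊x / t⌋₊) ⁻¹' {a} ∩ Set.Ici 0 : Set ℝ) =
      Set.Ico (a * t) ((a + 1) * t) := by
    ext x
    simp only [Set.mem_inter_iff, Set.mem_preimage, Set.mem_singleton_iff, Set.mem_Ici,
      Set.mem_Ico]
    constructor
    · rintro ⟨h, hx⟩
      rwa [Nat.floor_eq_iff (by positivity), le_div_iff₀ ht, div_lt_iff₀ ht] at h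
    · intro h
      have hx : 0 ≤ x := le_trans (by positivity) h.1
      refine ⟨?_, hx⟩
      rwa [Nat.floor_eq_iff (by positivity), le_div_iff₀ ht, div_lt_iff₀ ht]
  rw [this, Real.volume_Ico]
  congr 1
  ring

open MeasureTheory in
theorem tendsto_sq_mul_tsum_exp_latNorm :
    Tendsto (fun t : ℝ => t ^ 2 * ∑' p : ℕ × ℕ, rexp (-(t * latNorm p))) (𝓝[>] 0) (𝓝 (π / 2)) := by
  set μ : Measure (ℝ × ℝ) :=
    (volume.restrict (Set.Ioi (0 : ℝ))).prod (volume.restrict (Set.Ioi (0 : ℝ))) with hμ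
  let ψ : ℝ → ℝ × ℝ → ℕ × ℕ := fun t p => (⌊p.1 / t⌋₊, ⌊p.2 / t⌋₊)
  have hψ : ∀ t, Measurable (ψ t) := fun t => by
    refine Measurable.prodMk ?_ ?_
    · exact Nat.measurable_floor.comp (measurable_fst.div_const t)
    · exact Nat.measurable_floor.comp (measurable_snd.div_const t)
  have hmem : ∀ᵐ p ∂μ, 0 < p.1 ∧ 0 < p.2 := by
    rw [hμ, Measure.prod_restrict]
    exact ae_restrict_mem (measurableSet_Ioi.prod measurableSet_Ioi)
  have hbound_int : Integrable
      (fun p : ℝ × ℝ => (rexp 1 * rexp (-(1/2) * p.1)) * rexp (-(1/2) * p.2)) μ :=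
    ((integrableOn_exp_mul_Ioi (by norm_num) 0).const_mul _).mul_prod
      (integrableOn_exp_mul_Ioi (by norm_num) 0)
  have hmeas : ∀ t, Measurable fun p => rexp (-(t * latNorm (ψ t p))) := fun t =>
    (measurable_of_countable fun q : ℕ × ℕ => rexp (-(t * latNorm q))).comp (hψ t)
  have hlower : ∀ {t x : ℝ}, 0 < t → x - t ≤ t * (⌊x / t⌋₊ : ℝ) := fun {t x} ht => by
    have h := (Nat.lt_floor_add_one (x / t)).le
    rw [div_le_iff₀ ht] at h
    linarith
  have hupper : ∀ {t x : ℝ}, 0 < t → 0 < x → t * (⌊x / t⌋₊ : ℝ) ≤ x := fun {t x} ht hx => by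
    have h := Nat.floor_le (div_pos hx ht).le
    rw [le_div_iff₀ ht] at h
    linarith
  have hbound : ∀ t : ℝ, 0 < t → t ≤ 1 → ∀ᵐ p ∂μ, ‖rexp (-(t * latNorm (ψ t p)))‖ ≤
      (rexp 1 * rexp (-(1/2) * p.1)) * rexp (-(1/2) * p.2) := fun t ht ht1 => by
    filter_upwards [hmem] with p hp
    rw [Real.norm_of_nonneg (by positivity), ← Real.exp_add, ← Real.exp_add, Real.exp_le_exp]
    have h1 : ((⌊p.1 / t⌋₊ : ℝ) + (⌊p.2 / t⌋₊ : ℝ)) / 2 ≤ latNorm (ψ t p) :=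
      half_add_le_sqrt _ _
    have h2 := mul_le_mul_of_nonneg_left h1 ht.le
    have h3 := hlower (x := p.1) ht
    have h4 := hlower (x := p.2) ht
    linarith
  have hsum : ∀ t : ℝ, 0 < t → t ≤ 1 → ∫ p, rexp (-(t * latNorm (ψ t p))) ∂μ =
      t ^ 2 * ∑' p : ℕ × ℕ, rexp (-(t * latNorm p)) := fun t ht ht1 => by
    have hint : Integrable (fun p => rexp (-(t * latNorm (ψ t p)))) μ :=
      hbound_int.mono' (hmeas t).aestronglyMeasurable (hbound t ht ht1)
    have hsm : AEStronglyMeasurable (fun q : ℕ × ℕ => rexp (-(t * latNorm q))) (μ.map (ψ t)) :=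
      (measurable_of_countable _).aestronglyMeasurable
    rw [← integral_map (hψ t).aemeasurable hsm, integral_countable]
    · rw [← tsum_mul_left]
      congr 1
      ext q
      have : (μ.map (ψ t)).real {q} = t ^ 2 := by
        have hpre : ψ t ⁻¹' {q} = ((fun x : ℝ => ⌊x / t⌋₊) ⁻¹' {q.1}) ×ˢ
            ((fun x : ℝ => ⌊x / t⌋₊) ⁻¹' {q.2}) := by
          ext p
          simp [ψ, Prod.ext_iff]
        have hm : ∀ a : ℕ, MeasurableSet ((fun x : ℝ => ⌊x / t⌋₊) ⁻¹' {a}) := fun a =>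
          (Nat.measurable_floor.comp (measurable_id.div_const t)) (measurableSet_singleton a)
        rw [measureReal_def, Measure.map_apply (hψ t) (measurableSet_singleton q), hpre, hμ,
          Measure.prod_prod, Measure.restrict_apply (hm _), Measure.restrict_apply (hm _),
          volume_floor_div_preimage ht, volume_floor_div_preimage ht, ENNReal.toReal_mul,
          ENNReal.toReal_ofReal ht.le, sq]
      rw [this, smul_eq_mul]
    · exact (integrable_map_measure hsm (hψ t).aemeasurable).2 hint
  have hsmall : ∀ᶠ t : ℝ in 𝓝[>] 0, 0 < t ∧ t ≤ 1 := by
    filter_upwards [Ioc_mem_nhdsGT (zero_lt_one' ℝ)] with t ht using ht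
  have hlim : Tendsto (fun t => ∫ p, rexp (-(t * latNorm (ψ t p))) ∂μ) (𝓝[>] 0)
      (𝓝 (∫ p, rexp (-√(p.1 ^ 2 + p.2 ^ 2)) ∂μ)) := by
    refine tendsto_integral_filter_of_dominated_convergence _
      (.of_forall fun t => (hmeas t).aestronglyMeasurable) ?_ hbound_int ?_
    · filter_upwards [hsmall] with t ht using hbound t ht.1 ht.2
    · have hcoord : ∀ x : ℝ, 0 < x →
          Tendsto (fun t : ℝ => t * (⌊x / t⌋₊ : ℝ)) (𝓝[>] 0) (𝓝 x) := fun x hx => by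
        refine tendsto_of_tendsto_of_tendsto_of_le_of_le' (g := fun t => x - t) (h := fun _ => x)
          ?_ tendsto_const_nhds ?_ ?_
        · have : Tendsto (fun t : ℝ => x - t) (𝓝 0) (𝓝 (x - 0)) :=
            (continuous_const.sub continuous_id).tendsto 0
          rw [sub_zero] at this
          exact this.mono_left nhdsWithin_le_nhds
        · filter_upwards [hsmall] with t ht using hlower ht.1
        · filter_upwards [hsmall] with t ht using hupper ht.1 hx
      filter_upwards [hmem] with p hp
      have h := ((((hcoord p.1 hp.1).pow 2).add ((hcoord p.2 hp.2).pow 2)).sqrt).neg.rexp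
      refine h.congr' ?_
      filter_upwards [hsmall] with t ht
      congr 2
      rw [show (t * (⌊p.1 / t⌋₊ : ℝ)) ^ 2 + (t * (⌊p.2 / t⌋₊ : ℝ)) ^ 2 =
        t ^ 2 * ((⌊p.1 / t⌋₊ : ℝ) ^ 2 + (⌊p.2 / t⌋₊ : ℝ) ^ 2) by ring,
        Real.sqrt_mul (sq_nonneg t), Real.sqrt_sq ht.1.le]
      rfl
  rw [integral_quadrant_exp_neg_norm] at hlim
  refine hlim.congr' ?_
  filter_upwards [hsmall] with t ht using hsum t ht.1 ht.2

theorem one_le_latNorm {p : ℕ × ℕ} (hp : p ≠ 0) : 1 ≤ latNorm p := by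
  refine Real.le_sqrt_of_sq_le ?_
  have : 1 ≤ p.1 ^ 2 + p.2 ^ 2 := by
    by_contra! h
    refine hp (Prod.ext ?_ ?_) <;> simp only [Prod.fst_zero, Prod.snd_zero] <;> nlinarith
  rw [one_pow]
  exact_mod_cast this

theorem Xc.val_ne_zero (x : Xc) : x.val ≠ 0 := fun h => by
  have := x.property
  simp [h] at this

theorem one_le_latNorm_val (x : Xc) : 1 ≤ latNorm x.val := one_le_latNorm x.val_ne_zero

theorem latNorm_mul (k : ℕ) (p : ℕ × ℕ) : latNorm (k * p.1, k * p.2) = k * latNorm p := by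
  simp only [latNorm, Nat.cast_mul]
  rw [mul_pow, mul_pow, ← mul_add, Real.sqrt_mul (by positivity), Real.sqrt_sq (by positivity)]

theorem exp_latNorm_le {t : ℝ} (ht : 0 < t) (p : ℕ × ℕ) :
    rexp (-(t * latNorm p)) ≤ rexp (-(t / 2)) ^ p.1 * rexp (-(t / 2)) ^ p.2 := by
  rw [← Real.exp_nat_mul, ← Real.exp_nat_mul, ← Real.exp_add, Real.exp_le_exp]
  have := mul_le_mul_of_nonneg_left (half_add_le_sqrt (p.1 : ℝ) (p.2 : ℝ)) ht.le
  simp only [latNorm]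
  linarith

theorem hasSum_geometric_prod {q : ℝ} (hq0 : 0 ≤ q) (hq1 : q < 1) :
    HasSum (fun p : ℕ × ℕ => q ^ p.1 * q ^ p.2) ((1 - q)⁻¹ * (1 - q)⁻¹) := by
  have h := hasSum_geometric_of_lt_one hq0 hq1
  exact h.mul h (h.summable.mul_of_nonneg h.summable (fun _ => by positivity)
    (fun _ => by positivity))

theorem summable_exp_latNorm {t : ℝ} (ht : 0 < t) :
    Summable fun p : ℕ × ℕ => rexp (-(t * latNorm p)) :=
  (hasSum_geometric_prod (Real.exp_pos _).le
    (Real.exp_lt_one_iff.2 (by linarith : -(t / 2) < 0))).summable.of_nonneg_of_le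
      (fun _ => (Real.exp_pos _).le) (exp_latNorm_le ht)

/-- The sum of `exp (-t‖p‖)` over the nonzero `p ∈ ℕ × ℕ`. -/
noncomputable def latSum (t : ℝ) : ℝ :=
  ∑' p : ℕ × ℕ, if p = 0 then 0 else rexp (-(t * latNorm p))

/-- The sum of `exp (-t‖x‖)` over the primitive vectors `x`. -/
noncomputable def primSum (t : ℝ) : ℝ := ∑' x : Xc, rexp (-(t * latNorm x.val))

theorem latSum_eq {t : ℝ} (ht : 0 < t) :
    latSum t = ∑' p : ℕ × ℕ, rexp (-(t * latNorm p)) - 1 := by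
  rw [(summable_exp_latNorm ht).tsum_eq_add_tsum_ite 0, latSum]
  simp [latNorm]

theorem summable_latSum {t : ℝ} (ht : 0 < t) :
    Summable fun p : ℕ × ℕ => if p = 0 then 0 else rexp (-(t * latNorm p)) :=
  (summable_exp_latNorm ht).of_nonneg_of_le (fun p => by split_ifs <;> positivity)
    (fun p => by split_ifs <;> [positivity; exact le_rfl])

theorem latSum_nonneg (t : ℝ) : 0 ≤ latSum t :=
  tsum_nonneg fun p => by split_ifs <;> positivity

theorem latSum_le {t : ℝ} (ht : 0 < t) : latSum t ≤ 8 / t ^ 2 := by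
  set r := rexp (-(t / 4)) with hr
  have hr0 : 0 < r := Real.exp_pos _
  have hq : rexp (-(t / 2)) = r ^ 2 := by
    rw [hr, ← Real.exp_nat_mul]
    congr 1
    push_cast
    ring
  have hq1 : r ^ 2 < 1 := hq ▸ Real.exp_lt_one_iff.2 (by linarith)
  have hle : ∑' p : ℕ × ℕ, rexp (-(t * latNorm p)) ≤ (1 - r ^ 2)⁻¹ * (1 - r ^ 2)⁻¹ := by
    rw [← (hasSum_geometric_prod (sq_nonneg r) hq1).tsum_eq]
    refine (summable_exp_latNorm ht).tsum_le_tsum (fun p => ?_)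
      (hasSum_geometric_prod (sq_nonneg r) hq1).summable
    rw [← hq]
    exact exp_latNorm_le ht p
  have hsinh : r * (t / 2) ≤ 1 - r ^ 2 := by
    have h := Real.self_le_sinh_iff.2 (by linarith : 0 ≤ t / 4)
    rw [Real.sinh_eq, ← hr] at h
    have h' : r * rexp (t / 4) = 1 := by rw [hr, ← Real.exp_add]; simp
    nlinarith [mul_le_mul_of_nonneg_left h hr0.le]
  have hsq : r ^ 2 * (t ^ 2 / 4) ≤ (1 - r ^ 2) ^ 2 := by
    have := pow_le_pow_left₀ (by positivity) hsinh 2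
    nlinarith
  have hpos : 0 < 1 - r ^ 2 := by linarith
  rw [latSum_eq ht]
  refine (sub_le_sub_right hle 1).trans ?_
  rw [← mul_inv, ← sq, le_div_iff₀ (by positivity)]
  have : ((1 - r ^ 2) ^ 2)⁻¹ - 1 = r ^ 2 * (2 - r ^ 2) / (1 - r ^ 2) ^ 2 := by
    field_simp
    ring
  rw [this, div_mul_eq_mul_div, div_le_iff₀ (by positivity)]
  nlinarith [mul_nonneg (sq_nonneg r) (sq_nonneg t), sq_nonneg r,
    mul_nonneg (mul_nonneg (sq_nonneg r) (sq_nonneg t)) (sq_nonneg r)]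

theorem tendsto_sq_mul_latSum :
    Tendsto (fun t : ℝ => t ^ 2 * latSum t) (𝓝[>] 0) (𝓝 (π / 2)) := by
  have h2 : Tendsto (fun t : ℝ => t ^ 2) (𝓝[>] 0) (𝓝 0) := by
    have : Tendsto (fun t : ℝ => t ^ 2) (𝓝 0) (𝓝 (0 ^ 2)) := (continuous_pow 2).tendsto 0
    rw [zero_pow two_ne_zero] at this
    exact this.mono_left nhdsWithin_le_nhds
  have h := tendsto_sq_mul_tsum_exp_latNorm.sub h2
  rw [sub_zero] at h
  refine h.congr' ?_
  filter_upwards [self_mem_nhdsWithin] with t ht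
  rw [latSum_eq ht]
  ring

theorem hasSum_latSum_primitive {t : ℝ} (ht : 0 < t) :
    HasSum (fun z : ℕ+ × Xc => rexp (-((z.1 * t) * latNorm z.2.val))) (latSum t) := by
  let g : ℕ+ × Xc → ℕ × ℕ := fun z => (z.1 * z.2.val.1, z.1 * z.2.val.2)
  have hgcd : ∀ z, Nat.gcd (g z).1 (g z).2 = z.1 := fun z => by
    simp [g, Nat.gcd_mul_left, z.2.property]
  have hg : Function.Injective g := fun z w h => by
    have h1 : z.1 = w.1 := PNat.coe_injective (by rw [← hgcd z, ← hgcd w, h])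
    refine Prod.ext h1 (Subtype.ext (Prod.ext ?_ ?_))
    · have := congrArg Prod.fst h
      simp only [g, h1] at this
      exact Nat.eq_of_mul_eq_mul_left w.1.pos this
    · have := congrArg Prod.snd h
      simp only [g, h1] at this
      exact Nat.eq_of_mul_eq_mul_left w.1.pos this
  have hg0 : ∀ z, g z ≠ 0 := fun z hz => by
    have := hgcd z
    rw [hz] at this
    exact z.1.ne_zero (by simpa using this.symm)
  have hrange : ∀ p ∉ Set.range g, (if p = 0 then 0 else rexp (-(t * latNorm p))) = 0 :=
    fun p hp => by
      by_contra hne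
      have hp0 : p ≠ 0 := fun h => hne (if_pos h)
      have hpos : 0 < Nat.gcd p.1 p.2 := by
        rw [Nat.pos_iff_ne_zero, Ne, Nat.gcd_eq_zero_iff]
        exact fun h => hp0 (Prod.ext h.1 h.2)
      refine hp ⟨(⟨_, hpos⟩, ⟨(p.1 / Nat.gcd p.1 p.2, p.2 / Nat.gcd p.1 p.2),
        Nat.coprime_div_gcd_div_gcd hpos⟩), Prod.ext ?_ ?_⟩
      · exact Nat.mul_div_cancel' (Nat.gcd_dvd_left _ _)
      · exact Nat.mul_div_cancel' (Nat.gcd_dvd_right _ _)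
  have h := (hg.hasSum_iff hrange).2 (summable_latSum ht).hasSum
  rw [latSum]
  convert h using 2 with z
  simp only [Function.comp_apply, if_neg (hg0 z)]
  rw [latNorm_mul, ← mul_assoc, mul_comm t]

theorem summable_primSum {t : ℝ} (ht : 0 < t) :
    Summable fun x : Xc => rexp (-(t * latNorm x.val)) :=
  (summable_exp_latNorm ht).comp_injective Subtype.val_injective

theorem primSum_nonneg (t : ℝ) : 0 ≤ primSum t := tsum_nonneg fun _ => (Real.exp_pos _).le

theorem hasSum_primSum_latSum {t : ℝ} (ht : 0 < t) :
    HasSum (fun k : ℕ+ => primSum (k * t)) (latSum t) :=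
  (hasSum_latSum_primitive ht).prod_fiberwise fun k =>
    (summable_primSum (mul_pos (Nat.cast_pos.2 k.pos) ht)).hasSum

theorem primSum_le {t : ℝ} (ht : 0 < t) : primSum t ≤ 8 / t ^ 2 := by
  refine le_trans ?_ (latSum_le ht)
  have := le_hasSum (hasSum_primSum_latSum ht) 1 fun _ _ => primSum_nonneg _
  simpa using this

theorem summable_pnat_inv_sq : Summable fun d : ℕ+ => ((d : ℝ) ^ 2)⁻¹ :=
  (Real.summable_nat_pow_inv.2 one_lt_two).comp_injective PNat.coe_injective

open ArithmeticFunction in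
theorem hasSum_moebius_div_sq :
    HasSum (fun d : ℕ+ => (moebius d : ℝ) / (d : ℝ) ^ 2) (6 / π ^ 2) := by
  have hs : 1 < (2 : ℂ).re := by norm_num
  have hsum := (LSeriesSummable_moebius_iff.2 hs).LSeriesHasSum
  have hval : LSeries (fun n => ((moebius n : ℤ) : ℂ)) 2 = ((6 / π ^ 2 : ℝ) : ℂ) := by
    have h := LSeries_one_mul_Lseries_moebius hs
    rw [LSeries_one_eq_riemannZeta hs, riemannZeta_two] at h
    have hπ : (π : ℂ) ≠ 0 := by exact_mod_cast pi_ne_zero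
    push_cast
    field_simp at h ⊢
    linear_combination h
  rw [LSeriesHasSum, hval] at hsum
  rw [← Complex.hasSum_ofReal]
  have h := (PNat.coe_injective.hasSum_iff fun n hn => ?_).2 hsum
  · convert h using 2 with d
    simp only [Function.comp_apply, LSeries.term_of_ne_zero d.ne_zero]
    push_cast
    norm_cast
  · have : n = 0 := by
      by_contra h0
      exact hn ⟨⟨n, Nat.pos_of_ne_zero h0⟩, rfl⟩
    rw [this, LSeries.term_zero]

open ArithmeticFunction in
theorem primSum_eq_tsum_moebius {t : ℝ} (ht : 0 < t) :
    primSum t = ∑' d : ℕ+, (moebius d : ℝ) * latSum (d * t) := by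
  have hmoebius : ∀ d : ℕ, |((moebius d : ℤ) : ℝ)| ≤ 1 := fun d => by
    exact_mod_cast abs_moebius_le_one
  have hsummable : Summable fun z : ℕ+ × ℕ+ => (moebius z.1 : ℝ) * primSum (z.2 * (z.1 * t)) := by
    have hprod := (summable_pnat_inv_sq.mul_of_nonneg summable_pnat_inv_sq
      (fun _ => by positivity) (fun _ => by positivity)).mul_left (8 / t ^ 2)
    refine hprod.of_norm_bounded fun z => ?_
    have hz : 0 < (z.2 : ℝ) * (z.1 * t) := by
      have h1 : (0 : ℝ) < z.1 := Nat.cast_pos.2 z.1.pos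
      have h2 : (0 : ℝ) < z.2 := Nat.cast_pos.2 z.2.pos
      positivity
    rw [norm_mul, Real.norm_eq_abs, Real.norm_eq_abs, abs_of_nonneg (primSum_nonneg _)]
    refine (mul_le_mul (hmoebius _) (primSum_le hz) (primSum_nonneg _) zero_le_one).trans
      (le_of_eq ?_)
    field_simp
  have hfiber : ∑' z : ℕ+ × ℕ+, (moebius z.1 : ℝ) * primSum (z.2 * (z.1 * t)) =
      ∑' d : ℕ+, (moebius d : ℝ) * latSum (d * t) := by
    rw [hsummable.tsum_prod]
    refine tsum_congr fun d => ?_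
    simp only [tsum_mul_left]
    rw [(hasSum_primSum_latSum (mul_pos (Nat.cast_pos.2 d.pos) ht)).tsum_eq]
  have hsigma := (sigmaAntidiagonalEquivProd.summable_iff.2 hsummable).tsum_sigma
  simp only [Function.comp_apply] at hsigma
  rw [← hfiber, ← sigmaAntidiagonalEquivProd.tsum_eq, hsigma]
  have hdiv : ∀ n : ℕ+, ∑' c : (n : ℕ).divisorsAntidiagonal,
      ((moebius (sigmaAntidiagonalEquivProd ⟨n, c⟩).1 : ℤ) : ℝ) *
        primSum ((sigmaAntidiagonalEquivProd ⟨n, c⟩).2 *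
          ((sigmaAntidiagonalEquivProd ⟨n, c⟩).1 * t)) =
      if n = 1 then primSum t else 0 := fun n => by
    have h1 : ∀ c : (n : ℕ).divisorsAntidiagonal,
        ((moebius (sigmaAntidiagonalEquivProd ⟨n, c⟩).1 : ℤ) : ℝ) *
          primSum ((sigmaAntidiagonalEquivProd ⟨n, c⟩).2 *
            ((sigmaAntidiagonalEquivProd ⟨n, c⟩).1 * t)) =
        ((moebius c.val.1 : ℤ) : ℝ) * primSum (n * t) := fun c => by
      have hc := (Nat.mem_divisorsAntidiagonal.1 c.property).1
      have hn : (n : ℝ) = c.val.1 * c.val.2 := by exact_mod_cast hc.symm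
      rw [hn]
      simp only [sigmaAntidiagonalEquivProd, divisorsAntidiagonalFactors, Equiv.coe_fn_mk,
        PNat.mk_coe]
      congr 2
      ring
    rw [tsum_congr h1, tsum_mul_right, tsum_fintype,
      Finset.sum_coe_sort _ (fun c : ℕ × ℕ => ((moebius c.1 : ℤ) : ℝ))]
    have h2 := congrArg (fun f : ArithmeticFunction ℤ => f n) moebius_mul_coe_zeta
    simp only [mul_apply, one_apply] at h2
    have h3 : ∑ c ∈ (n : ℕ).divisorsAntidiagonal, moebius c.1 = if (n : ℕ) = 1 then 1 else 0 := by
      rw [← h2]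
      refine Finset.sum_congr rfl fun c hc => ?_
      have : c.2 ≠ 0 := 
        (Nat.pos_of_mem_divisors (Nat.snd_mem_divisors_of_mem_antidiagonal hc)).ne'
      simp [natCoe_apply, zeta_apply, this]
    have h4 : ∑ c ∈ (n : ℕ).divisorsAntidiagonal, ((moebius c.1 : ℤ) : ℝ) =
        if (n : ℕ) = 1 then 1 else 0 := by exact_mod_cast h3
    rw [h4]
    simp only [PNat.coe_eq_one_iff]
    split_ifs with h <;> simp [h]
  rw [tsum_congr hdiv, tsum_ite_eq]

open ArithmeticFunction in
theorem tendsto_sq_mul_primSum :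
    Tendsto (fun t : ℝ => t ^ 2 * primSum t) (𝓝[>] 0) (𝓝 (3 / π)) := by
  have hlim : Tendsto (fun t : ℝ => ∑' d : ℕ+, (moebius d : ℝ) / (d : ℝ) ^ 2 *
      ((d * t) ^ 2 * latSum (d * t))) (𝓝[>] 0)
      (𝓝 (∑' d : ℕ+, (moebius d : ℝ) / (d : ℝ) ^ 2 * (π / 2))) := by
    refine tendsto_tsum_of_dominated_convergence (summable_pnat_inv_sq.mul_left 8) ?_ ?_
    · intro d
      refine Tendsto.const_mul _ (tendsto_sq_mul_latSum.comp ?_)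
      have hd : (0 : ℝ) < d := Nat.cast_pos.2 d.pos
      refine tendsto_nhdsWithin_iff.2 ⟨?_, ?_⟩
      · have : Tendsto (fun t : ℝ => d * t) (𝓝 0) (𝓝 (d * 0)) :=
          (continuous_const.mul continuous_id).tendsto 0
        rw [mul_zero] at this
        exact this.mono_left nhdsWithin_le_nhds
      · filter_upwards [self_mem_nhdsWithin] with t ht using mul_pos hd ht
    · filter_upwards [self_mem_nhdsWithin] with t ht d
      have hd : (0 : ℝ) < d := Nat.cast_pos.2 d.pos
      have hdt : 0 < d * t := mul_pos hd ht
      have hm : |((moebius d : ℤ) : ℝ)| ≤ 1 := by exact_mod_cast abs_moebius_le_one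
      have hl := latSum_le hdt
      rw [le_div_iff₀ (by positivity)] at hl
      rw [norm_mul, norm_div, Real.norm_eq_abs, Real.norm_of_nonneg (by positivity : 0 ≤ (d:ℝ) ^ 2),
        Real.norm_of_nonneg (mul_nonneg (sq_nonneg _) (latSum_nonneg _)), div_eq_mul_inv, mul_assoc,
        mul_comm 8]
      refine (mul_le_of_le_one_left (mul_nonneg (by positivity)
        (mul_nonneg (sq_nonneg _) (latSum_nonneg _))) hm).trans ?_
      gcongr
      linarith
  rw [tsum_mul_right, hasSum_moebius_div_sq.tsum_eq] at hlim
  have hval : 6 / π ^ 2 * (π / 2) = 3 / π := by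
    field_simp
    norm_num
  rw [hval] at hlim
  refine hlim.congr' ?_
  filter_upwards [self_mem_nhdsWithin] with t ht
  rw [primSum_eq_tsum_moebius ht, ← tsum_mul_left]
  refine tsum_congr fun d => ?_
  have hd : (d : ℝ) ≠ 0 := Nat.cast_ne_zero.2 d.ne_zero
  field_simp

theorem HasSum.of_forall_eq {ι : Type*} {f g : ι → ℝ} {a : ℝ} (hg : HasSum g a)
    (h : ∀ i, f i = g i) : HasSum f a :=
  (funext h : f = g) ▸ hg

/-- The logarithm of the generating function `∑ exp (-β L(ν))` of lattice chains by length. -/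
noncomputable def logPart (β : ℝ) : ℝ := ∑' x : Xc, -Real.log (1 - rexp (-(β * latNorm x.val)))

theorem exp_latNorm_lt_one {β : ℝ} (hβ : 0 < β) (x : Xc) : rexp (-(β * latNorm x.val)) < 1 :=
  Real.exp_lt_one_iff.2 (neg_lt_zero.2 (mul_pos hβ (zero_lt_one.trans_le (one_le_latNorm_val x))))

theorem hasSum_logPart_primSum {β : ℝ} (hβ : 0 < β) :
    Summable (fun x : Xc => -Real.log (1 - rexp (-(β * latNorm x.val)))) ∧
      logPart β = ∑' k : ℕ, primSum ((k + 1) * β) / (k + 1) := by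
  let F : ℕ × Xc → ℝ := fun z => rexp (-(β * latNorm z.2.val)) ^ (z.1 + 1) / (z.1 + 1)
  have hF0 : 0 ≤ F := fun z => by simp only [F, Pi.zero_apply]; positivity
  have hfiber : ∀ k : ℕ, HasSum (fun x => F (k, x)) (primSum ((k + 1) * β) / (k + 1)) := fun k => by
    have h := (summable_primSum (mul_pos (Nat.cast_add_one_pos (α := ℝ) k) hβ)).hasSum.div_const
      ((k : ℝ) + 1)
    refine h.of_forall_eq fun x => ?_
    simp only [F]
    rw [← Real.exp_nat_mul]
    congr 2
    push_cast
    ring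
  have hF : Summable F := by
    refine (summable_prod_of_nonneg hF0).2 ⟨fun k => (hfiber k).summable, ?_⟩
    simp only [(hfiber _).tsum_eq]
    have hsq := ((summable_nat_add_iff 1).2 (Real.summable_nat_pow_inv.2 one_lt_two)).mul_left
      (8 / β ^ 2)
    refine hsq.of_nonneg_of_le (fun k => div_nonneg (primSum_nonneg _) (by positivity)) fun k => ?_
    have hk : (0 : ℝ) < k + 1 := Nat.cast_add_one_pos k
    refine (div_le_self (primSum_nonneg _) (by linarith [Nat.cast_nonneg (α := ℝ) k])).trans
      ((primSum_le (mul_pos hk hβ)).trans (le_of_eq ?_))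
    push_cast
    field_simp
  have hlog : ∀ x : Xc, HasSum (fun k => F (k, x)) (-Real.log (1 - rexp (-(β * latNorm x.val)))) :=
    fun x => by
      have habs : |rexp (-(β * latNorm x.val))| < 1 := by
        rw [abs_of_pos (Real.exp_pos _)]
        exact exp_latNorm_lt_one hβ x
      exact (Real.hasSum_pow_div_log_of_abs_lt_one habs).of_forall_eq fun k => rfl
  have hswap : HasSum (fun z : Xc × ℕ => F (z.2, z.1)) (∑' z, F z) :=
    (Equiv.prodComm Xc ℕ).hasSum_iff.2 hF.hasSum
  have hx := HasSum.prod_fiberwise (f := fun z : Xc × ℕ => F (z.2, z.1)) hswap hlog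
  refine ⟨hx.summable, ?_⟩
  rw [logPart, hx.tsum_eq, (hF.hasSum.prod_fiberwise hfiber).tsum_eq]

theorem summable_zeta3 : Summable fun k : ℕ => 1 / ((k : ℝ) + 1) ^ 3 := by
  have h := (summable_nat_add_iff 1).2 (Real.summable_nat_pow_inv (p := 3).2 (by norm_num))
  simpa using h

theorem zeta3_pos : 0 < zeta3 :=
  summable_zeta3.tsum_pos (fun k => by positivity) 0 (by norm_num)

theorem tendsto_sq_mul_logPart :
    Tendsto (fun β : ℝ => β ^ 2 * logPart β) (𝓝[>] 0) (𝓝 (3 * zeta3 / π)) := by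
  have hlim : Tendsto (fun β : ℝ => ∑' k : ℕ, 1 / ((k : ℝ) + 1) ^ 3 *
      (((k + 1) * β) ^ 2 * primSum ((k + 1) * β))) (𝓝[>] 0)
      (𝓝 (∑' k : ℕ, 1 / ((k : ℝ) + 1) ^ 3 * (3 / π))) := by
    refine tendsto_tsum_of_dominated_convergence (summable_zeta3.mul_right 8) ?_ ?_
    · intro k
      refine Tendsto.const_mul _ (tendsto_sq_mul_primSum.comp ?_)
      have hk : (0 : ℝ) < k + 1 := Nat.cast_add_one_pos k
      refine tendsto_nhdsWithin_iff.2 ⟨?_, ?_⟩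
      · have : Tendsto (fun t : ℝ => (k + 1) * t) (𝓝 0) (𝓝 ((k + 1) * 0)) :=
          (continuous_const.mul continuous_id).tendsto 0
        rw [mul_zero] at this
        exact this.mono_left nhdsWithin_le_nhds
      · filter_upwards [self_mem_nhdsWithin] with t ht using mul_pos hk ht
    · filter_upwards [self_mem_nhdsWithin] with β hβ k
      have hkβ : 0 < (k + 1) * β := mul_pos (Nat.cast_add_one_pos k) hβ
      have hl := primSum_le hkβ
      rw [le_div_iff₀ (by positivity)] at hl
      rw [Real.norm_of_nonneg (mul_nonneg (by positivity)
        (mul_nonneg (sq_nonneg _) (primSum_nonneg _)))]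
      gcongr
      linarith
  rw [tsum_mul_right] at hlim
  have hval : (∑' k : ℕ, 1 / ((k : ℝ) + 1) ^ 3) * (3 / π) = 3 * zeta3 / π := by
    rw [zeta3]
    ring
  rw [hval] at hlim
  refine hlim.congr' ?_
  filter_upwards [self_mem_nhdsWithin] with β hβ
  rw [(hasSum_logPart_primSum hβ).2, ← tsum_mul_left]
  refine tsum_congr fun k => ?_
  have hk : (k : ℝ) + 1 ≠ 0 := Nat.cast_add_one_ne_zero k
  field_simp

theorem sum_finsupp_range_prod {ι : Type*} (f : ι → ℕ → ℝ) (hf0 : ∀ i, f i 0 = 1)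
    (F : Finset ι) (M : ℕ) :
    ∑ ν ∈ F.finsupp (fun _ => Finset.range M), ν.prod f =
      ∏ i ∈ F, ∑ k ∈ Finset.range M, f i k := by
  classical
  rw [Finset.prod_sum, Finset.finsupp, Finset.sum_map]
  refine Finset.sum_congr rfl fun p _ => ?_
  exact Finsupp.prod_indicator_index_eq_prod_attach p fun i _ => hf0 i

theorem hasSum_finsupp_prod {ι : Type*} (f : ι → ℕ → ℝ) (hf0 : ∀ i, f i 0 = 1)
    (hf : ∀ i k, 0 ≤ f i k) (l : ι → ℝ) (hfl : ∀ i, HasSum (f i) (rexp (l i))) (hl : Summable l) :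
    HasSum (fun ν : ι →₀ ℕ => ν.prod f) (rexp (∑' i, l i)) := by
  classical
  have hprod0 : ∀ ν : ι →₀ ℕ, 0 ≤ ν.prod f := fun ν => Finset.prod_nonneg fun i _ => hf i _
  have hl0 : ∀ i, 0 ≤ l i := fun i => by
    rw [← Real.one_le_exp_iff, ← hf0 i]
    exact le_hasSum (hfl i) 0 fun k _ => hf i k
  have hbound : ∀ T : Finset (ι →₀ ℕ), ∑ ν ∈ T, ν.prod f ≤ rexp (∑' i, l i) := fun T => by
    set F := T.biUnion Finsupp.support
    set M := T.sup fun ν => F.sup ν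
    have hT : T ⊆ F.finsupp (fun _ => Finset.range (M + 1)) := fun ν hν => by
      refine Finset.mem_finsupp_iff.2 ⟨Finset.subset_biUnion_of_mem _ hν, fun i hi => ?_⟩
      rw [Finset.mem_range, Nat.lt_succ_iff]
      exact (Finset.le_sup (f := ν) hi).trans (Finset.le_sup (f := fun ν : ι →₀ ℕ => F.sup ν) hν)
    calc ∑ ν ∈ T, ν.prod f
        ≤ ∑ ν ∈ F.finsupp (fun _ => Finset.range (M + 1)), ν.prod f :=
          Finset.sum_le_sum_of_subset_of_nonneg hT fun ν _ _ => hprod0 ν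
      _ = ∏ i ∈ F, ∑ k ∈ Finset.range (M + 1), f i k := sum_finsupp_range_prod f hf0 F (M + 1)
      _ ≤ ∏ i ∈ F, rexp (l i) := Finset.prod_le_prod
          (fun i _ => Finset.sum_nonneg fun k _ => hf i k)
          fun i _ => sum_le_hasSum _ (fun k _ => hf i k) (hfl i)
      _ = rexp (∑ i ∈ F, l i) := (Real.exp_sum F l).symm
      _ ≤ rexp (∑' i, l i) := Real.exp_le_exp.2 (hl.sum_le_tsum F fun i _ => hl0 i)
  have hsummable : Summable fun ν : ι →₀ ℕ => ν.prod f := summable_of_sum_le hprod0 hbound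
  have hge : rexp (∑' i, l i) ≤ ∑' ν : ι →₀ ℕ, ν.prod f := by
    have hF : ∀ F : Finset ι, rexp (∑ i ∈ F, l i) ≤ ∑' ν : ι →₀ ℕ, ν.prod f := fun F => by
      have hlim : Tendsto (fun M => ∏ i ∈ F, ∑ k ∈ Finset.range M, f i k) atTop
          (𝓝 (∏ i ∈ F, rexp (l i))) :=
        tendsto_finsetProd F fun i _ => (hfl i).tendsto_sum_nat
      rw [Real.exp_sum]
      refine le_of_tendsto' hlim fun M => ?_
      rw [← sum_finsupp_range_prod f hf0]
      exact hsummable.sum_le_tsum _ fun ν _ => hprod0 ν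
    exact le_of_tendsto' ((Real.continuous_exp.tendsto _).comp hl.hasSum) hF
  rw [le_antisymm hge (hsummable.tsum_le_of_sum_le hbound)]
  exact hsummable.hasSum

theorem totalLength_eq (ν : Xc →₀ ℕ) :
    totalLength ν = ∑ x ∈ ν.support, (ν x : ℝ) * latNorm x.val := rfl

theorem hasSum_exp_totalLength_mul_pow {β y : ℝ} (hβ : 0 < β) (hy : 0 < y) :
    ∃ B, HasSum (fun ν : Xc →₀ ℕ => rexp (-(β * totalLength ν)) * y ^ ν.support.card) (rexp B) ∧
      B ≤ logPart β + (y - 1) * primSum β ∧ (y = 1 → B = logPart β) := by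
  let q : Xc → ℝ := fun x => rexp (-(β * latNorm x.val))
  let f : Xc → ℕ → ℝ := fun x k => if k = 0 then 1 else q x ^ k * y
  let l : Xc → ℝ := fun x => Real.log (1 + q x * (1 - q x)⁻¹ * y)
  have hq0 : ∀ x, 0 < q x := fun x => Real.exp_pos _
  have hq1 : ∀ x, 0 < 1 - q x := fun x => sub_pos.2 (exp_latNorm_lt_one hβ x)
  have harg : ∀ x, 0 < 1 + (y - 1) * q x := fun x => by
    nlinarith [hq0 x, hq1 x, mul_pos hy (hq0 x)]
  have hfl : ∀ x, HasSum (f x) (rexp (l x)) := fun x => by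
    have hgeom := (((hasSum_geometric_of_lt_one (hq0 x).le
      (sub_pos.1 (hq1 x))).mul_left (q x)).mul_right y)
    have hpos : 0 < 1 + q x * (1 - q x)⁻¹ * y := by
      have := hq0 x
      have := hq1 x
      positivity
    simp only [l]
    rw [Real.exp_log hpos]
    have hshift : HasSum (fun k => f x (k + 1)) (q x * (1 - q x)⁻¹ * y) := by
      refine hgeom.of_forall_eq fun k => ?_
      simp only [f, Nat.succ_ne_zero, if_false, pow_succ']
    have h := (hasSum_nat_add_iff 1).1 hshift
    rw [Finset.sum_range_one, add_comm] at h
    exact h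
  have hl_eq : ∀ x, l x = -Real.log (1 - q x) + Real.log (1 + (y - 1) * q x) := fun x => by
    have : 1 + q x * (1 - q x)⁻¹ * y = (1 + (y - 1) * q x) / (1 - q x) := by
      have := (hq1 x).ne'
      field_simp
      ring
    simp only [l]
    rw [this, Real.log_div (harg x).ne' (hq1 x).ne']
    ring
  have hl_le : ∀ x, l x ≤ -Real.log (1 - q x) + (y - 1) * q x := fun x => by
    rw [hl_eq]
    linarith [Real.log_le_sub_one_of_pos (harg x)]
  have hl0 : ∀ x, 0 ≤ l x := fun x => Real.log_nonneg (by
    have := hq0 x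
    have := hq1 x
    have : 0 < q x * (1 - q x)⁻¹ * y := by positivity
    linarith)
  have hmajor := (hasSum_logPart_primSum hβ).1.hasSum.add
    ((summable_primSum hβ).hasSum.mul_left (y - 1))
  have hl : Summable l := hmajor.summable.of_nonneg_of_le hl0 hl_le
  refine ⟨∑' x, l x, ?_, hasSum_le hl_le hl.hasSum hmajor, ?_⟩
  · have h := hasSum_finsupp_prod f (fun x => if_pos rfl)
      (fun x k => by simp only [f]; have := hq0 x; split_ifs <;> positivity) l hfl hl
    convert h using 2 with ν
    have hprod : ν.prod f = ∏ x ∈ ν.support, (rexp (-(β * (ν x * latNorm x.val))) * y) :=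
      Finset.prod_congr rfl fun x hx => by
        simp only [f, q, if_neg (Finsupp.mem_support_iff.1 hx)]
        rw [← Real.exp_nat_mul]
        congr 2
        ring
    rw [hprod, Finset.prod_mul_distrib, Finset.prod_const, ← Real.exp_sum, totalLength_eq,
      Finset.sum_neg_distrib, Finset.mul_sum]
  · rintro rfl
    refine tsum_congr fun x => ?_
    rw [hl_eq]
    simp [q]

theorem hasSum_exp_totalLength {β : ℝ} (hβ : 0 < β) :
    HasSum (fun ν : Xc →₀ ℕ => rexp (-(β * totalLength ν))) (rexp (logPart β)) := by
  obtain ⟨B, hB, -, h1⟩ := hasSum_exp_totalLength_mul_pow hβ zero_lt_one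
  simpa [h1 rfl] using hB

theorem finite_and_card_mul_le {α : Type*} {f : α → ℝ} {a c : ℝ} (hf : HasSum f a)
    (hf0 : ∀ x, 0 ≤ f x) (hc : 0 < c) {P : α → Prop} (hP : ∀ x, P x → c ≤ f x) :
    Finite {x // P x} ∧ (Nat.card {x // P x} : ℝ) * c ≤ a := by
  have hfin : {x | P x}.Finite := by
    have h := hf.summable.tendsto_cofinite_zero.eventually (gt_mem_nhds hc)
    rw [eventually_cofinite] at h
    exact h.subset fun x hx => not_lt.2 (hP x hx)
  refine ⟨hfin, ?_⟩
  have hcard : Nat.card {x // P x} = hfin.toFinset.card := Nat.card_eq_card_finite_toFinset hfin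
  rw [hcard, ← nsmul_eq_mul, ← Finset.sum_const]
  exact (Finset.sum_le_sum fun x hx => hP x (hfin.mem_toFinset.1 hx)).trans
    (sum_le_hasSum _ (fun x _ => hf0 x) hf)

theorem finite_totalLength_le (T : ℝ) : Finite {ν : Xc →₀ ℕ // totalLength ν ≤ T} :=
  (finite_and_card_mul_le (hasSum_exp_totalLength zero_lt_one) (fun _ => (Real.exp_pos _).le)
    (Real.exp_pos (-T)) fun _ hν => Real.exp_le_exp.2 (by linarith)).1

theorem exp_logPart_le {β t : ℝ} (hβ : 0 < β) (ht0 : 0 < t) (ht1 : t < 1) (lo hi : ℝ) :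
    rexp (logPart β) ≤ Nat.card {ν : Xc →₀ ℕ // totalLength ν ≤ hi} * rexp (-(β * lo)) +
      rexp (-(t * β * hi) + logPart ((1 - t) * β)) +
      rexp (t * β * lo + logPart ((1 + t) * β)) := by
  classical
  have hfin : {ν : Xc →₀ ℕ | totalLength ν ≤ hi}.Finite := finite_totalLength_le hi
  have hmid : HasSum (fun ν : Xc →₀ ℕ => if totalLength ν ≤ hi then rexp (-(β * lo)) else 0)
      (Nat.card {ν : Xc →₀ ℕ // totalLength ν ≤ hi} * rexp (-(β * lo))) := by
    have h := hasSum_sum_of_ne_finset_zero (L := SummationFilter.unconditional _)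
      (s := hfin.toFinset)
      (f := fun ν : Xc →₀ ℕ => if totalLength ν ≤ hi then rexp (-(β * lo)) else 0)
      (fun ν hν => if_neg fun h => hν (hfin.mem_toFinset.2 h))
    have hcard : Nat.card {ν : Xc →₀ ℕ // totalLength ν ≤ hi} = hfin.toFinset.card :=
      Nat.card_eq_card_finite_toFinset hfin
    have hsum : ∑ ν ∈ hfin.toFinset, (if totalLength ν ≤ hi then rexp (-(β * lo)) else 0) =
        ∑ ν ∈ hfin.toFinset, rexp (-(β * lo)) :=
      Finset.sum_congr rfl fun ν hν => if_pos (hfin.mem_toFinset.1 hν)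
    rwa [hsum, Finset.sum_const, nsmul_eq_mul, ← hcard] at h
  have hhi := (hasSum_exp_totalLength (mul_pos (sub_pos.2 ht1) hβ)).mul_left
    (rexp (-(t * β * hi)))
  have hlo := (hasSum_exp_totalLength (mul_pos (by linarith : 0 < 1 + t) hβ)).mul_left
    (rexp (t * β * lo))
  rw [Real.exp_add, Real.exp_add]
  refine hasSum_le (fun ν => ?_) (hasSum_exp_totalLength hβ) ((hmid.add hhi).add hlo)
  rw [← Real.exp_add, ← Real.exp_add]
  have htβ : 0 < t * β := mul_pos ht0 hβ
  have e1 := Real.exp_pos (-(t * β * hi) + -((1 - t) * β * totalLength ν))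
  have e2 := Real.exp_pos (t * β * lo + -((1 + t) * β * totalLength ν))
  split_ifs with h
  · rcases le_or_gt lo (totalLength ν) with h' | h'
    · have : rexp (-(β * totalLength ν)) ≤ rexp (-(β * lo)) :=
        Real.exp_le_exp.2 (neg_le_neg (mul_le_mul_of_nonneg_left h' hβ.le))
      linarith
    · have : rexp (-(β * totalLength ν)) ≤ rexp (t * β * lo + -((1 + t) * β * totalLength ν)) :=
        Real.exp_le_exp.2 (by nlinarith [mul_lt_mul_of_pos_left h' htβ])
      linarith [Real.exp_pos (-(β * lo))]
  · have : rexp (-(β * totalLength ν)) ≤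
        rexp (-(t * β * hi) + -((1 - t) * β * totalLength ν)) :=
      Real.exp_le_exp.2 (by nlinarith [mul_lt_mul_of_pos_left (not_le.1 h) htβ])
    linarith

/-- The constant `C` in `logPart β ~ C / β ^ 2` as `β → 0`. -/
noncomputable def growthConst : ℝ := 3 * zeta3 / π

theorem growthConst_pos : 0 < growthConst :=
  div_pos (mul_pos three_pos zeta3_pos) pi_pos

theorem tendsto_sq_mul_logPart_mul {c : ℝ} (hc : 0 < c) :
    Tendsto (fun β : ℝ => β ^ 2 * logPart (c * β)) (𝓝[>] 0) (𝓝 (growthConst / c ^ 2)) := by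
  have hcβ : Tendsto (fun β : ℝ => c * β) (𝓝[>] 0) (𝓝[>] 0) := by
    refine tendsto_nhdsWithin_iff.2 ⟨?_, ?_⟩
    · have : Tendsto (fun t : ℝ => c * t) (𝓝 0) (𝓝 (c * 0)) :=
        (continuous_const.mul continuous_id).tendsto 0
      rw [mul_zero] at this
      exact this.mono_left nhdsWithin_le_nhds
    · filter_upwards [self_mem_nhdsWithin] with t ht using mul_pos hc ht
  refine ((tendsto_sq_mul_logPart.comp hcβ).div_const (c ^ 2)).congr fun β => ?_
  simp only [Function.comp_apply]
  field_simp

theorem tendsto_sq_mul_const (c : ℝ) :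
    Tendsto (fun β : ℝ => β ^ 2 * c) (𝓝[>] 0) (𝓝 0) := by
  have : Tendsto (fun t : ℝ => t ^ 2 * c) (𝓝 0) (𝓝 (0 ^ 2 * c)) :=
    ((continuous_pow 2).mul continuous_const).tendsto 0
  rw [zero_pow two_ne_zero, zero_mul] at this
  exact this.mono_left nhdsWithin_le_nhds

theorem eventually_exp_le_card_totalLength_le {η : ℝ} (hη0 : 0 < η) (hη1 : η < 1) :
    ∀ᶠ β : ℝ in 𝓝[>] 0, rexp ((3 - 3 * η) * growthConst / β ^ 2) ≤
      Nat.card {ν : Xc →₀ ℕ // totalLength ν ≤ (1 + η) * (2 * growthConst / β ^ 3)} := by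
  set C := growthConst with hC
  have hCpos : 0 < C := growthConst_pos
  obtain ⟨t, rfl⟩ : ∃ t, η = 4 * t := ⟨η / 4, by ring⟩
  have ht0 : 0 < t := by linarith
  have ht1 : t < 1 / 4 := by linarith
  have hΛ := tendsto_sq_mul_logPart_mul zero_lt_one
  simp only [one_mul, one_pow, div_one] at hΛ
  have hhi : ∀ᶠ β : ℝ in 𝓝[>] 0,
      β ^ 2 * logPart ((1 - t) * β) - 2 * C * t * (1 + 4 * t) - β ^ 2 * logPart β
        + β ^ 2 * Real.log 4 < 0 := by
    have h := (((tendsto_sq_mul_logPart_mul (by linarith : 0 < 1 - t)).sub_const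
      (2 * C * t * (1 + 4 * t))).sub hΛ).add (tendsto_sq_mul_const (Real.log 4))
    refine h.eventually (gt_mem_nhds ?_)
    have : C / (1 - t) ^ 2 < C * (1 + 2 * t + 8 * t ^ 2) := by
      rw [div_lt_iff₀ (by nlinarith), mul_assoc]
      refine lt_mul_of_one_lt_right hCpos ?_
      nlinarith [mul_pos ht0 ht0, mul_pos (mul_pos ht0 ht0) (sub_pos.2 ht1),
        mul_pos (mul_pos ht0 ht0) (mul_pos ht0 ht0)]
    rw [← hC]
    nlinarith
  have hlo : ∀ᶠ β : ℝ in 𝓝[>] 0,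
      β ^ 2 * logPart ((1 + t) * β) + 2 * C * t * (1 - 4 * t) - β ^ 2 * logPart β
        + β ^ 2 * Real.log 4 < 0 := by
    have h := (((tendsto_sq_mul_logPart_mul (by linarith : 0 < 1 + t)).add_const
      (2 * C * t * (1 - 4 * t))).sub hΛ).add (tendsto_sq_mul_const (Real.log 4))
    refine h.eventually (gt_mem_nhds ?_)
    have : C / (1 + t) ^ 2 < C * (1 - 2 * t + 8 * t ^ 2) := by
      rw [div_lt_iff₀ (by nlinarith), mul_assoc]
      refine lt_mul_of_one_lt_right hCpos ?_
      nlinarith [mul_pos ht0 ht0, mul_pos (mul_pos ht0 ht0) ht0,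
        mul_pos (mul_pos ht0 ht0) (mul_pos ht0 ht0)]
    rw [← hC]
    nlinarith
  have hmain : ∀ᶠ β : ℝ in 𝓝[>] 0, (3 - 3 * (4 * t)) * C <
      β ^ 2 * logPart β + 2 * C * (1 - 4 * t) - β ^ 2 * Real.log 2 := by
    have h := (hΛ.add_const (2 * C * (1 - 4 * t))).sub (tendsto_sq_mul_const (Real.log 2))
    refine h.eventually (lt_mem_nhds ?_)
    rw [← hC]
    nlinarith [mul_pos hCpos ht0]
  filter_upwards [hhi, hlo, hmain, self_mem_nhdsWithin] with β h1 h2 h3 hβ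
  have hβ : 0 < β := hβ
  have hβ2 : 0 < β ^ 2 := by positivity
  set lo := (1 - 4 * t) * (2 * C / β ^ 3)
  set hi := (1 + 4 * t) * (2 * C / β ^ 3)
  have hβlo : β * lo = 2 * C * (1 - 4 * t) / β ^ 2 := by simp only [lo]; field_simp
  have hβhi : β * hi = 2 * C * (1 + 4 * t) / β ^ 2 := by simp only [hi]; field_simp
  have hkey := exp_logPart_le hβ ht0 (by linarith) lo hi
  have h4 : rexp (-Real.log 4) = 1 / 4 := by rw [Real.exp_neg, Real.exp_log (by norm_num)]; norm_num
  have hterm1 : rexp (-(t * β * hi) + logPart ((1 - t) * β)) ≤ rexp (logPart β) * (1 / 4) := by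
    rw [← h4, ← Real.exp_add, Real.exp_le_exp, mul_assoc, hβhi]
    generalize logPart ((1 - t) * β) = u at h1 ⊢
    refine le_of_mul_le_mul_left ?_ hβ2
    field_simp
    linarith
  have hterm2 : rexp (t * β * lo + logPart ((1 + t) * β)) ≤ rexp (logPart β) * (1 / 4) := by
    rw [← h4, ← Real.exp_add, Real.exp_le_exp, mul_assoc, hβlo]
    generalize logPart ((1 + t) * β) = u at h2 ⊢
    refine le_of_mul_le_mul_left ?_ hβ2
    field_simp
    linarith
  have hhalf : rexp (logPart β) * rexp (-Real.log 2) ≤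
      Nat.card {ν : Xc →₀ ℕ // totalLength ν ≤ hi} * rexp (-(β * lo)) := by
    rw [Real.exp_neg, Real.exp_log two_pos]
    linarith
  have hcard : rexp (logPart β + -Real.log 2 + β * lo) ≤
      Nat.card {ν : Xc →₀ ℕ // totalLength ν ≤ hi} := by
    rw [Real.exp_add, Real.exp_add]
    calc _ ≤ _ := mul_le_mul_of_nonneg_right hhalf (Real.exp_pos _).le
      _ = _ := by rw [mul_assoc, ← Real.exp_add, neg_add_cancel, Real.exp_zero, mul_one]
  refine le_trans (Real.exp_le_exp.2 ?_) hcard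
  rw [div_le_iff₀ hβ2, hβlo]
  have : 2 * C * (1 - 4 * t) / β ^ 2 * β ^ 2 = 2 * C * (1 - 4 * t) := by field_simp
  nlinarith

theorem exists_int_add_mul_sqrt_two_mem_Ioo {δ : ℝ} (hδ : 0 < δ) :
    ∃ p q : ℤ, 0 < p + q * √2 ∧ p + q * √2 < δ := by
  have hdense : Dense (AddSubgroup.closure {1, √2} : Set ℝ) := by
    rw [dense_addSubgroupClosure_pair_iff, one_div]
    exact irrational_inv_iff.2 irrational_sqrt_two
  obtain ⟨g, hg, hgmem⟩ := hdense.exists_mem_open isOpen_Ioo (Set.nonempty_Ioo.2 hδ)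
  obtain ⟨p, q, rfl⟩ := AddSubgroup.mem_closure_pair.1 hg
  refine ⟨p, q, ?_⟩
  simpa using hgmem

theorem exists_add_mul_sqrt_two_mem_Icc {δ : ℝ} (hδ : 0 < δ) :
    ∃ R : ℝ, ∀ t, R ≤ t → ∃ m k : ℕ, t ≤ m + k * √2 ∧ m + k * √2 ≤ t + δ := by
  obtain ⟨p, q, hg0, hgδ⟩ := exists_int_add_mul_sqrt_two_mem_Ioo hδ
  set g : ℝ := p + q * √2 with hg
  let J : ℕ := ⌈1 / g⌉₊
  refine ⟨J * |p| + 1 + J * |q| * √2, fun t ht => ?_⟩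
  set m₀ : ℤ := ⌊t - J * |q| * √2⌋ with hm₀
  have hm₀_le : (m₀ : ℝ) ≤ t - J * |q| * √2 := Int.floor_le _
  have hm₀_lt : t - J * |q| * √2 < m₀ + 1 := Int.lt_floor_add_one _
  have hm₀J : (J : ℤ) * |p| ≤ m₀ := by
    refine Int.le_floor.2 ?_
    simp only [Int.cast_mul, Int.cast_natCast]
    linarith
  set s : ℝ := t - (m₀ + J * |q| * √2) with hs
  have hs0 : 0 ≤ s := by linarith
  let j : ℕ := ⌈s / g⌉₊
  have hjJ : j ≤ J := Nat.ceil_le_ceil (div_le_div_of_nonneg_right (by linarith) hg0.le)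
  have hj_ge : s ≤ j * g := (div_le_iff₀ hg0).1 (Nat.le_ceil _)
  have hj_lt : j * g < s + g := by
    have h := Nat.ceil_lt_add_one (div_nonneg hs0 hg0.le)
    have h' := mul_lt_mul_of_pos_right h hg0
    rwa [add_mul, one_mul, div_mul_cancel₀ _ hg0.ne'] at h'
  have hbig : ∀ a : ℤ, 0 ≤ (J : ℤ) * |a| + j * a := fun a => by
    have h1 : (j : ℤ) * |a| ≤ J * |a| :=
      mul_le_mul_of_nonneg_right (by exact_mod_cast hjJ) (abs_nonneg a)
    have h2 : (j : ℤ) * -|a| ≤ j * a :=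
      mul_le_mul_of_nonneg_left (neg_abs_le a) (Int.natCast_nonneg j)
    linarith
  obtain ⟨m, hm⟩ := Int.eq_ofNat_of_zero_le (show 0 ≤ m₀ + j * p by linarith [hbig p])
  obtain ⟨k, hk⟩ := Int.eq_ofNat_of_zero_le (hbig q)
  have hm' : (m : ℝ) = m₀ + j * p := by exact_mod_cast hm.symm
  have hk' : (k : ℝ) = J * |q| + j * q := by exact_mod_cast hk.symm
  have hsum : m + k * √2 = (t - s) + j * g := by
    rw [hm', hk', hs, hg]
    push_cast
    ring
  refine ⟨m, k, ?_, ?_⟩ <;> linarith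

/-- The chain edge `(1, 0)`. -/
abbrev Xc.horizontal : Xc := ⟨(1, 0), rfl⟩

/-- The chain edge `(1, 1)`. -/
abbrev Xc.diagonal : Xc := ⟨(1, 1), rfl⟩

theorem totalLength_add (ν ν' : Xc →₀ ℕ) :
    totalLength (ν + ν') = totalLength ν + totalLength ν' :=
  Finsupp.sum_add_index' (by simp) (fun x m m' => by push_cast; ring)

theorem totalLength_nonneg (ν : Xc →₀ ℕ) : 0 ≤ totalLength ν :=
  Finset.sum_nonneg fun _ _ => by positivity

theorem totalLength_fill (m k : ℕ) :
    totalLength (Finsupp.single Xc.horizontal m + Finsupp.single Xc.diagonal k) = m + k * √2 := by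
  rw [totalLength_add, totalLength, totalLength, Finsupp.sum_single_index (by simp),
    Finsupp.sum_single_index (by simp)]
  norm_num

theorem finite_totalLength_mem_Icc (a b : ℝ) :
    Finite {ν : Xc →₀ ℕ // totalLength ν ∈ Set.Icc a b} :=
  (Set.Finite.subset (finite_totalLength_le b : {ν : Xc →₀ ℕ | totalLength ν ≤ b}.Finite)
    fun _ hν => hν.2 : {ν : Xc →₀ ℕ | totalLength ν ∈ Set.Icc a b}.Finite)

theorem exists_card_totalLength_le_le {δ : ℝ} (hδ : 0 < δ) :
    ∃ R : ℝ, ∀ s : ℝ, 0 ≤ s →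
      (Nat.card {ν : Xc →₀ ℕ // totalLength ν ≤ s - R} : ℝ) ≤
        (s + δ + 1) ^ 2 * Nat.card {ν : Xc →₀ ℕ // totalLength ν ∈ Set.Icc s (s + δ)} := by
  obtain ⟨R, hR⟩ := exists_add_mul_sqrt_two_mem_Icc hδ
  refine ⟨R, fun s hs => ?_⟩
  set K := ⌊s + δ⌋₊ + 1
  have hfill : ∀ ν : {ν : Xc →₀ ℕ // totalLength ν ≤ s - R}, ∃ m k : ℕ,
      s - totalLength ν.val ≤ m + k * √2 ∧ m + k * √2 ≤ s - totalLength ν.val + δ :=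
    fun ν => hR _ (by linarith [ν.property])
  choose m k hmk using hfill
  have hsqrt : 1 ≤ √2 := Real.le_sqrt_of_sq_le (by norm_num)
  have hm : ∀ ν, m ν < K := fun ν => by
    refine Nat.lt_succ_of_le (Nat.le_floor ?_)
    have := totalLength_nonneg ν.val
    have : 0 ≤ k ν * √2 := by positivity
    linarith [(hmk ν).2]
  have hk : ∀ ν, k ν < K := fun ν => by
    refine Nat.lt_succ_of_le (Nat.le_floor ?_)
    have := totalLength_nonneg ν.val
    have : (k ν : ℝ) * 1 ≤ k ν * √2 := mul_le_mul_of_nonneg_left hsqrt (Nat.cast_nonneg _)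
    linarith [(hmk ν).2, Nat.cast_nonneg (α := ℝ) (m ν)]
  let Φ : {ν : Xc →₀ ℕ // totalLength ν ≤ s - R} →
      (Fin K × Fin K) × {ν : Xc →₀ ℕ // totalLength ν ∈ Set.Icc s (s + δ)} := fun ν =>
    ((⟨m ν, hm ν⟩, ⟨k ν, hk ν⟩), ⟨ν.val +
      (Finsupp.single Xc.horizontal (m ν) + Finsupp.single Xc.diagonal (k ν)), by
        rw [totalLength_add, totalLength_fill]
        constructor <;> linarith [(hmk ν).1, (hmk ν).2]⟩)
  have hΦ : Function.Injective Φ := fun ν ν' h => by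
    simp only [Φ, Prod.mk.injEq, Fin.mk.injEq, Subtype.mk.injEq] at h
    obtain ⟨⟨h1, h2⟩, h3⟩ := h
    rw [h1, h2] at h3
    exact Subtype.ext (add_right_cancel h3)
  have := finite_totalLength_mem_Icc s (s + δ)
  have hcard := Nat.card_le_card_of_injective Φ hΦ
  rw [Nat.card_prod, Nat.card_prod, Nat.card_fin] at hcard
  have hK : (K : ℝ) ≤ s + δ + 1 := by
    simp only [K]
    push_cast
    linarith [Nat.floor_le (by linarith : 0 ≤ s + δ)]
  calc (Nat.card {ν : Xc →₀ ℕ // totalLength ν ≤ s - R} : ℝ)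
      ≤ (K * K : ℝ) * Nat.card {ν : Xc →₀ ℕ // totalLength ν ∈ Set.Icc s (s + δ)} := by
        exact_mod_cast hcard
    _ ≤ _ := by
        rw [← sq]
        gcongr

theorem card_totalLength_le_and_le {β : ℝ} (hβ : 0 < β) (s b a : ℝ) :
    (Nat.card {ν : Xc →₀ ℕ // totalLength ν ≤ a ∧ s * b ≤ s * ν.support.card} : ℝ) ≤
      rexp (β * a - s * b + logPart β + (rexp s - 1) * primSum β) := by
  obtain ⟨B, hB, hBle, -⟩ := hasSum_exp_totalLength_mul_pow hβ (Real.exp_pos s)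
  have h := (finite_and_card_mul_le hB (fun ν => by positivity)
    (Real.exp_pos (-(β * a) + s * b))
    (P := fun ν => totalLength ν ≤ a ∧ s * b ≤ s * ν.support.card) fun ν hν => by
      rw [← Real.exp_nat_mul, ← Real.exp_add]
      have := mul_le_mul_of_nonneg_left hν.1 hβ.le
      exact Real.exp_le_exp.2 (by linarith [hν.2])).2
  rw [← le_div_iff₀ (Real.exp_pos _), ← Real.exp_sub] at h
  exact h.trans (Real.exp_le_exp.2 (by linarith))

theorem eventually_card_le_exp {δ s b κ : ℝ}
    (hκ : (rexp s - 1) * (3 / π) - s * b < -κ) :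
    ∀ᶠ β : ℝ in 𝓝[>] 0,
      (Nat.card {ν : Xc →₀ ℕ // totalLength ν ≤ 2 * growthConst / β ^ 3 + δ ∧
        s * (b / β ^ 2) ≤ s * ν.support.card} : ℝ) ≤ rexp ((3 * growthConst - κ) / β ^ 2) := by
  have hlog : Tendsto (fun β : ℝ => β ^ 2 * logPart β) (𝓝[>] 0) (𝓝 growthConst) :=
    tendsto_sq_mul_logPart
  have hβ : Tendsto (fun β : ℝ => β ^ 3 * δ) (𝓝[>] 0) (𝓝 0) := by
    have h : Tendsto (fun β : ℝ => β ^ 3 * δ) (𝓝 0) (𝓝 (0 ^ 3 * δ)) :=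
      (by fun_prop : Continuous fun β : ℝ => β ^ 3 * δ).tendsto 0
    rw [zero_pow three_ne_zero, zero_mul] at h
    exact h.mono_left nhdsWithin_le_nhds
  have h := (((hβ.const_add (2 * growthConst - s * b)).add hlog).add
    (tendsto_sq_mul_primSum.const_mul (rexp s - 1))).eventually_lt_const
    (show _ < 3 * growthConst - κ by linarith)
  filter_upwards [h, self_mem_nhdsWithin] with β hlt hpos
  have hpos : 0 < β := hpos
  refine (card_totalLength_le_and_le hpos _ _ _).trans (Real.exp_le_exp.2 ?_)
  rw [le_div_iff₀ (by positivity)]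
  refine le_trans (le_of_eq ?_) hlt.le
  field_simp
  ring

/-- The large-deviation exponent for the number of vertices. -/
theorem exists_exp_tilt_lt {ε : ℝ} (hε : 0 < ε) :
    ∃ κ > 0, ∃ s > 0, (rexp s - 1) * (3 / π) - s * (3 / π + ε) < -κ ∧
      (rexp (-s) - 1) * (3 / π) - -s * (3 / π - ε) < -κ := by
  have hA : (0 : ℝ) < 3 / π := by positivity
  set A : ℝ := 3 / π
  obtain ⟨s, hs0, hs⟩ := exists_between (lt_min one_pos (div_pos hε (mul_pos two_pos hA)))
  obtain ⟨hs1, hs2⟩ := lt_min_iff.1 hs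
  rw [lt_div_iff₀ (mul_pos two_pos hA)] at hs2
  have hquad : ∀ r : ℝ, |r| = s → (rexp r - 1 - r) * A ≤ s * ε / 2 := fun r hr => by
    have h := (le_abs_self _).trans (Real.abs_exp_sub_one_sub_id_le (x := r) (by linarith))
    rw [← sq_abs, hr] at h
    have h' := mul_le_mul_of_nonneg_right h hA.le
    nlinarith
  have h1 := hquad s (abs_of_pos hs0)
  have h2 := hquad (-s) (by rw [abs_neg, abs_of_pos hs0])
  have hsε := mul_pos hs0 hε
  exact ⟨s * ε / 4, by positivity, s, hs0, by linarith, by linarith⟩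

theorem exists_eventually_card_deviation_le {δ ε : ℝ} (hε : 0 < ε) :
    ∃ κ > 0, ∀ᶠ β : ℝ in 𝓝[>] 0,
      (Nat.card {ν : Xc →₀ ℕ //
        totalLength ν ∈ Set.Icc (2 * growthConst / β ^ 3) (2 * growthConst / β ^ 3 + δ) ∧
          ε / β ^ 2 < |(ν.support.card : ℝ) - 3 / π / β ^ 2|} : ℝ) ≤
        2 * rexp ((3 * growthConst - κ) / β ^ 2) := by
  obtain ⟨κ, hκ, s, hs, h1, h2⟩ := exists_exp_tilt_lt hε
  refine ⟨κ, hκ, ?_⟩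
  filter_upwards [eventually_card_le_exp (δ := δ) h1, eventually_card_le_exp (δ := δ) h2]
    with β hu hl
  set a := 2 * growthConst / β ^ 3 + δ
  let U : Set (Xc →₀ ℕ) :=
    {ν | totalLength ν ≤ a ∧ s * ((3 / π + ε) / β ^ 2) ≤ s * ν.support.card}
  let D : Set (Xc →₀ ℕ) :=
    {ν | totalLength ν ≤ a ∧ -s * ((3 / π - ε) / β ^ 2) ≤ -s * ν.support.card}
  have hfin : {ν : Xc →₀ ℕ | totalLength ν ≤ a}.Finite := finite_totalLength_le a
  have hsub : {ν : Xc →₀ ℕ |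
      totalLength ν ∈ Set.Icc (2 * growthConst / β ^ 3) a ∧
        ε / β ^ 2 < |(ν.support.card : ℝ) - 3 / π / β ^ 2|} ⊆ U ∪ D := by
    rintro ν ⟨hν, hdev⟩
    rcases lt_abs.1 hdev with h | h
    · refine Or.inl ⟨hν.2, mul_le_mul_of_nonneg_left ?_ hs.le⟩
      rw [add_div]
      linarith
    · refine Or.inr ⟨hν.2, mul_le_mul_of_nonpos_left ?_ (neg_nonpos.2 hs.le)⟩
      rw [sub_div]
      linarith
  have hUD : (U ∪ D).Finite := (hfin.subset fun ν h => h.1).union (hfin.subset fun ν h => h.1)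
  have hle := (Set.ncard_le_ncard hsub hUD).trans (Set.ncard_union_le U D)
  rw [two_mul (rexp _)]
  exact (Nat.cast_le.2 hle).trans (by push_cast; exact add_le_add hu hl)

theorem eventually_exp_le_mul_card {δ κ : ℝ} (hδ : 0 < δ) (hκ : 0 < κ) :
    ∀ᶠ β : ℝ in 𝓝[>] 0, rexp ((3 * growthConst - κ) / β ^ 2) ≤
      (2 * growthConst / β ^ 3 + δ + 1) ^ 2 * Nat.card {ν : Xc →₀ ℕ //
        totalLength ν ∈ Set.Icc (2 * growthConst / β ^ 3) (2 * growthConst / β ^ 3 + δ)} := by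
  have hC := growthConst_pos
  obtain ⟨R, hR⟩ := exists_card_totalLength_le_le hδ
  obtain ⟨η, hη0, hη⟩ := exists_between
    (lt_min one_pos (div_pos hκ (mul_pos (by norm_num : (0 : ℝ) < 9) hC)))
  obtain ⟨hη1, hη2⟩ := lt_min_iff.1 hη
  rw [lt_div_iff₀ (by positivity)] at hη2
  have hscale : Tendsto (fun β : ℝ => (1 + η) * β) (𝓝[>] 0) (𝓝[>] 0) := by
    refine tendsto_nhdsWithin_iff.2 ⟨?_, ?_⟩
    · have : Tendsto (fun t : ℝ => (1 + η) * t) (𝓝 0) (𝓝 ((1 + η) * 0)) :=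
        (continuous_const.mul continuous_id).tendsto 0
      rw [mul_zero] at this
      exact this.mono_left nhdsWithin_le_nhds
    · filter_upwards [self_mem_nhdsWithin] with β hβ
      exact mul_pos (add_pos one_pos hη0) hβ
  have hR' : ∀ᶠ β : ℝ in 𝓝[>] 0, β ^ 3 * R < 2 * growthConst * (1 - 1 / (1 + η) ^ 2) := by
    have h : Tendsto (fun β : ℝ => β ^ 3 * R) (𝓝 0) (𝓝 (0 ^ 3 * R)) :=
      (by fun_prop : Continuous fun β : ℝ => β ^ 3 * R).tendsto 0
    rw [zero_pow three_ne_zero, zero_mul] at h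
    refine (h.mono_left nhdsWithin_le_nhds).eventually_lt_const (mul_pos (by positivity) ?_)
    rw [sub_pos, div_lt_one (by positivity)]
    nlinarith
  filter_upwards [hscale.eventually (eventually_exp_le_card_totalLength_le hη0 hη1), hR',
    self_mem_nhdsWithin] with β h hβR hβ
  have hβ : 0 < β := hβ
  set n := 2 * growthConst / β ^ 3 with hn
  have hn0 : 0 ≤ n := by positivity
  have hlevel : (1 + η) * (2 * growthConst / ((1 + η) * β) ^ 3) ≤ n - R := by
    have h1 : (1 + η) * (2 * growthConst / ((1 + η) * β) ^ 3) = n * (1 / (1 + η) ^ 2) := by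
      rw [hn]
      field_simp
    have h2 : R ≤ n * (1 - 1 / (1 + η) ^ 2) := by
      rw [hn, div_mul_eq_mul_div, le_div_iff₀ (by positivity)]
      linarith
    rw [h1]
    linarith
  have hexp : (3 * growthConst - κ) / β ^ 2 ≤
      (3 - 3 * η) * growthConst / ((1 + η) * β) ^ 2 := by
    rw [mul_pow, ← div_div]
    refine div_le_div_of_nonneg_right ?_ (by positivity)
    rw [le_div_iff₀ (by positivity)]
    have hcubic : (3 - 9 * η) * (1 + η) ^ 2 ≤ 3 - 3 * η := by nlinarith [pow_pos hη0 3]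
    have h1 := mul_le_mul_of_nonneg_right hcubic hC.le
    have h2 : (3 * growthConst - κ) * (1 + η) ^ 2 ≤
        (3 - 9 * η) * growthConst * (1 + η) ^ 2 :=
      mul_le_mul_of_nonneg_right (by linarith) (by positivity)
    linarith
  refine (Real.exp_le_exp.2 hexp).trans (h.trans (le_trans ?_ (hR n hn0)))
  have hfin : {ν : Xc →₀ ℕ | totalLength ν ≤ n - R}.Finite := finite_totalLength_le _
  exact Nat.cast_le.2 (Set.ncard_le_ncard (fun ν hν => le_trans hν hlevel) hfin)

theorem tendsto_add_one_sq_mul_exp_neg_div {δ c : ℝ} (hδ : 0 < δ) (hc : 0 < c) :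
    Tendsto (fun β : ℝ => (2 * growthConst / β ^ 3 + δ + 1) ^ 2 * rexp (-(c / β ^ 2)))
      (𝓝[>] 0) (𝓝 0) := by
  have hC := growthConst_pos
  have hinv : Tendsto (fun β : ℝ => c / β ^ 2) (𝓝[>] 0) atTop := by
    have h := (tendsto_pow_atTop two_ne_zero).comp (tendsto_inv_nhdsGT_zero (𝕜 := ℝ))
    refine (h.const_mul_atTop hc).congr fun β => ?_
    simp [div_eq_mul_inv]
  have h := ((tendsto_pow_mul_exp_neg_atTop_nhds_zero 4).comp hinv).const_mul
    ((2 * growthConst + δ + 1) ^ 2 / c ^ 4)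
  rw [mul_zero] at h
  refine squeeze_zero' (Eventually.of_forall fun β => by positivity) ?_ h
  filter_upwards [Ioo_mem_nhdsGT one_pos] with β hβ
  obtain ⟨hβ0, hβ1⟩ := hβ
  have h4 : β ^ 4 ≤ β ^ 3 := pow_le_pow_of_le_one hβ0.le hβ1.le (by norm_num)
  have h1 : 2 * growthConst / β ^ 3 + δ + 1 ≤ (2 * growthConst + δ + 1) / β ^ 4 := by
    have e1 : 2 * growthConst / β ^ 3 ≤ 2 * growthConst / β ^ 4 :=
      div_le_div_of_nonneg_left (by positivity) (by positivity) h4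
    have e2 : δ + 1 ≤ (δ + 1) / β ^ 4 :=
      le_div_self (by positivity) (by positivity) (pow_le_one₀ hβ0.le hβ1.le)
    rw [add_assoc, add_assoc, add_div]
    exact add_le_add e1 e2
  calc _ ≤ ((2 * growthConst + δ + 1) / β ^ 4) ^ 2 * rexp (-(c / β ^ 2)) := by gcongr
    _ = _ := by
      simp only [Function.comp_apply]
      field_simp

theorem tendsto_card_deviation_div_card {δ ε : ℝ} (hδ : 0 < δ) (hε : 0 < ε) :
    Tendsto (fun β : ℝ =>
      (Nat.card {ν : Xc →₀ ℕ //
        totalLength ν ∈ Set.Icc (2 * growthConst / β ^ 3) (2 * growthConst / β ^ 3 + δ) ∧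
          ε / β ^ 2 < |(ν.support.card : ℝ) - 3 / π / β ^ 2|} : ℝ) /
        Nat.card {ν : Xc →₀ ℕ //
          totalLength ν ∈ Set.Icc (2 * growthConst / β ^ 3) (2 * growthConst / β ^ 3 + δ)})
      (𝓝[>] 0) (𝓝 0) := by
  obtain ⟨κ, hκ, hup⟩ := exists_eventually_card_deviation_le (δ := δ) hε
  have hlim := (tendsto_add_one_sq_mul_exp_neg_div hδ (half_pos hκ)).const_mul 2
  rw [mul_zero] at hlim
  refine squeeze_zero' (Eventually.of_forall fun β => by positivity) ?_ hlim
  filter_upwards [hup, eventually_exp_le_mul_card hδ (half_pos hκ)] with β hu hl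
  set P := (2 * growthConst / β ^ 3 + δ + 1) ^ 2
  set N : ℝ := (Nat.card {ν : Xc →₀ ℕ //
    totalLength ν ∈ Set.Icc (2 * growthConst / β ^ 3) (2 * growthConst / β ^ 3 + δ)} : ℝ)
  have hN : 0 < N := by
    rcases (show 0 ≤ N from Nat.cast_nonneg _).eq_or_lt with h | h
    · rw [← h, mul_zero] at hl
      exact absurd hl (not_le.2 (Real.exp_pos _))
    · exact h
  rw [div_le_iff₀ hN]
  calc _ ≤ 2 * rexp ((3 * growthConst - κ) / β ^ 2) := hu
    _ = 2 * (rexp (-(κ / 2 / β ^ 2)) * rexp ((3 * growthConst - κ / 2) / β ^ 2)) := by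
      rw [← Real.exp_add]
      ring_nf
    _ ≤ 2 * (rexp (-(κ / 2 / β ^ 2)) * (P * N)) := by gcongr
    _ = _ := by ring

/-- The parameter `β` for which the Boltzmann weight `exp (-β * totalLength ν)` concentrates on
chains of total length close to `n`. -/
noncomputable def saddle (n : ℝ) : ℝ := (2 * growthConst / n) ^ ((1 : ℝ) / 3)

theorem saddle_pow_three {n : ℝ} (hn : 0 < n) : 2 * growthConst / saddle n ^ 3 = n := by
  have hC := growthConst_pos
  rw [saddle, ← Real.rpow_natCast, ← Real.rpow_mul (by positivity)]
  norm_num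
  field_simp

theorem div_saddle_sq {n : ℝ} (hn : 0 < n) :
    (2 * growthConst) ^ ((2 : ℝ) / 3) / saddle n ^ 2 = n ^ ((2 : ℝ) / 3) := by
  have hC := growthConst_pos
  rw [saddle, ← Real.rpow_natCast, ← Real.rpow_mul (by positivity),
    Real.div_rpow (by positivity) hn.le]
  norm_num
  field_simp

theorem tendsto_saddle : Tendsto (fun n : ℕ => saddle n) atTop (𝓝[>] 0) := by
  have hC := growthConst_pos
  refine tendsto_nhdsWithin_iff.2 ⟨?_, ?_⟩
  · have h := (tendsto_const_div_atTop_nhds_zero_nat (2 * growthConst)).rpow_const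
      (p := (1 : ℝ) / 3) (Or.inr (by norm_num))
    rwa [Real.zero_rpow (by norm_num)] at h
  · filter_upwards [eventually_gt_atTop 0] with n hn
    have : (0 : ℝ) < n := Nat.cast_pos.2 hn
    exact Real.rpow_pos_of_pos (by positivity) _

theorem vertexConst_mul_rpow :
    (3 / (4 * π * zeta3 ^ 2)) ^ ((1 : ℝ) / 3) * (2 * growthConst) ^ ((2 : ℝ) / 3) = 3 / π := by
  have hz := zeta3_pos
  have hC := growthConst_pos
  have h : (2 * growthConst) ^ ((2 : ℝ) / 3) = ((2 * growthConst) ^ 2) ^ ((1 : ℝ) / 3) := by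
    rw [← Real.rpow_natCast, ← Real.rpow_mul (by positivity)]
    norm_num
  have h3 : 3 / (4 * π * zeta3 ^ 2) * (2 * growthConst) ^ 2 = (3 / π) ^ 3 := by
    rw [growthConst]
    field_simp
    norm_num
  rw [h, ← Real.mul_rpow (by positivity) (by positivity), h3, ← Real.rpow_natCast,
    ← Real.rpow_mul (by positivity)]
  norm_num

/-- The typical number of vertices of an element of `Π̃_{n,n+δ}` is asymptotically
`(3/(4π·ζ(3)²))^{1/3}·n^{2/3}`: for every `ε > 0`, the proportion of chains whose number of
vertices deviates from this value by more than `ε·n^{2/3}` tends to `0`. -/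
theorem statement12 (δ : ℝ) (hδ : 0 < δ) (ε : ℝ) (hε : 0 < ε) :
    Tendsto (fun n : ℕ =>
        (Nat.card {ν : Xc →₀ ℕ // totalLength ν ∈ Set.Icc (n : ℝ) ((n : ℝ) + δ) ∧
            ε * (n : ℝ) ^ ((2:ℝ)/3) <
              |(ν.support.card : ℝ) -
                (3 / (4 * π * zeta3 ^ 2)) ^ ((1:ℝ)/3) * (n : ℝ) ^ ((2:ℝ)/3)|} : ℝ)
          / (Nat.card {ν : Xc →₀ ℕ //
              totalLength ν ∈ Set.Icc (n : ℝ) ((n : ℝ) + δ)} : ℝ))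
      atTop (nhds 0) := by
  have hK : (0 : ℝ) < (2 * growthConst) ^ ((2 : ℝ) / 3) :=
    Real.rpow_pos_of_pos (mul_pos two_pos growthConst_pos) _
  refine ((tendsto_card_deviation_div_card hδ (mul_pos hε hK)).comp tendsto_saddle).congr' ?_
  filter_upwards [eventually_gt_atTop 0] with n hn
  have hn' : (0 : ℝ) < n := Nat.cast_pos.2 hn
  simp only [Function.comp_apply, saddle_pow_three hn']
  simp only [← vertexConst_mul_rpow, mul_div_assoc, div_saddle_sq hn']
end

section
/- For every real M > 2 there exist constants C₁ > 0 and C₂ > 0 such that for all real x and y: 2·sin²x + M·sin²(x+y) − sin²y ≥ C₁·sin²x and 2·sin²x + M·sin²(x+y) − sin²y ≥ C₂·sin²y. (This rests on the fact that for M > 2 the quadratic form 2x² + M(x+y)² − y² is positive definite.) -/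
open Real

/-- The sine is subadditive up to absolute values. -/
theorem abs_sin_le_abs_sin_add_abs_sin (x y : ℝ) :
    |sin y| ≤ |sin (x + y)| + |sin x| := by
  have h : sin y = sin (x + y) * cos x - cos (x + y) * sin x := by
    rw [← sin_sub]
    congr 1
    ring
  calc |sin y| = |sin (x + y) * cos x - cos (x + y) * sin x| := by rw [← h]
    _ ≤ |sin (x + y) * cos x| + |cos (x + y) * sin x| := abs_sub _ _
    _ = |sin (x + y)| * |cos x| + |cos (x + y)| * |sin x| := by rw [abs_mul, abs_mul]
    _ ≤ |sin (x + y)| * 1 + 1 * |sin x| := by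
      gcongr
      · exact abs_cos_le_one x
      · exact abs_cos_le_one (x + y)
    _ = |sin (x + y)| + |sin x| := by ring

/-- For every `M > 2` there are constants `C₁, C₂ > 0` such that for all real `x, y`:
`2·sin²x + M·sin²(x+y) − sin²y ≥ C₁·sin²x` and `2·sin²x + M·sin²(x+y) − sin²y ≥ C₂·sin²y`. -/
theorem statement18 (M : ℝ) (hM : 2 < M) :
    ∃ C₁ : ℝ, 0 < C₁ ∧ ∃ C₂ : ℝ, 0 < C₂ ∧ ∀ x y : ℝ,
      C₁ * Real.sin x ^ 2 ≤
        2 * Real.sin x ^ 2 + M * Real.sin (x + y) ^ 2 - Real.sin y ^ 2 ∧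
      C₂ * Real.sin y ^ 2 ≤
        2 * Real.sin x ^ 2 + M * Real.sin (x + y) ^ 2 - Real.sin y ^ 2 := by
  have h₁ : 0 < M - 1 := by linarith
  have h₂ : 0 < M + 2 := by linarith
  refine ⟨(M - 2) / (M - 1), div_pos (by linarith) h₁,
    (M - 2) / (M + 2), div_pos (by linarith) h₂, fun x y => ?_⟩
  have hb : sin y ^ 2 ≤ (|sin (x + y)| + |sin x|) ^ 2 := by
    rw [← sq_abs (sin y)]
    gcongr
    exact abs_sin_le_abs_sin_add_abs_sin x y
  rw [← sq_abs (sin x), ← sq_abs (sin (x + y))]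
  generalize |sin x| = a at *
  generalize |sin (x + y)| = p at *
  generalize sin y ^ 2 = b at *
  constructor
  · rw [div_mul_eq_mul_div, div_le_iff₀ h₁]
    nlinarith [sq_nonneg (a - (M - 1) * p), mul_le_mul_of_nonneg_left hb h₁.le]
  · rw [div_mul_eq_mul_div, div_le_iff₀ h₂]
    nlinarith [sq_nonneg (2 * a - M * p), mul_le_mul_of_nonneg_left hb (by linarith : 0 ≤ 2 * M)]
end
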